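/- arXiv:2604.11157 — 2 statements merged into one kernel-verified Lean document; each statement's English description precedes it below -/
import Mathlib

section
/- Let λ : ℕ → ℝ satisfy 0 < λ n for every n, and let a, b : ℕ → ℂ satisfy Summable (fun n => ‖a n‖) and Summable (fun n => ‖b n‖). Define f, g : ℝ → ℂ by f t = ∑' n, a n * Complex.exp (-(λ n) * t) and g t = ∑' n, b n * Complex.exp (-(λ n) * t). If there exist real numbers 0 ≤ t₁ < t̃₁ such that f t = g t for all t in the open interval (t₁, t̃₁), then f t = g t for all t > 0. -/
/-- A Dirichlet series with summable coefficients and nonnegative exponents is holomorphic on the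
open right half-plane. -/
theorem differentiableOn_tsum_mul_exp_neg_mul {ι : Type*} {lam : ι → ℝ} (hlam : ∀ n, 0 ≤ lam n)
    {a : ι → ℂ} (ha : Summable fun n => ‖a n‖) :
    DifferentiableOn ℂ (fun z : ℂ => ∑' n, a n * Complex.exp (-(lam n : ℂ) * z))
      {z : ℂ | 0 < z.re} := by
  refine Complex.differentiableOn_tsum_of_summable_norm ha (fun n => by fun_prop)
    (isOpen_lt continuous_const Complex.continuous_re) fun n z hz => ?_
  rw [norm_mul, Complex.norm_exp]
  refine mul_le_of_le_one_right (norm_nonneg _) (Real.exp_le_one_iff.2 ?_)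
  simpa using mul_nonneg (hlam n) (le_of_lt hz)

/-- A Dirichlet series with summable coefficients and nonnegative exponents is real analytic on
the positive half-line. -/
theorem analyticOnNhd_tsum_mul_exp_neg_mul {ι : Type*} {lam : ι → ℝ} (hlam : ∀ n, 0 ≤ lam n)
    {a : ι → ℂ} (ha : Summable fun n => ‖a n‖) :
    AnalyticOnNhd ℝ (fun t : ℝ => ∑' n, a n * Complex.exp (-(lam n : ℂ) * (t : ℂ)))
      (Set.Ioi 0) := by
  intro t ht
  have h := (differentiableOn_tsum_mul_exp_neg_mul hlam ha).analyticOnNhd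
    (isOpen_lt continuous_const Complex.continuous_re) (t : ℂ) (by simpa using ht)
  exact (h.restrictScalars (𝕜 := ℝ)).comp (Complex.ofRealCLM.analyticAt t)

theorem dirichlet_series_unique_extension
    (lam : ℕ → ℝ) (hlam : ∀ n, 0 < lam n)
    (a b : ℕ → ℂ)
    (ha : Summable (fun n => ‖a n‖)) (hb : Summable (fun n => ‖b n‖))
    (f g : ℝ → ℂ)
    (hf : ∀ t : ℝ, f t = ∑' n, a n * Complex.exp (-(lam n : ℂ) * (t : ℂ)))
    (hg : ∀ t : ℝ, g t = ∑' n, b n * Complex.exp (-(lam n : ℂ) * (t : ℂ)))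
    (t₁ t₁' : ℝ) (ht₁ : 0 ≤ t₁) (ht : t₁ < t₁')
    (heq : ∀ t ∈ Set.Ioo t₁ t₁', f t = g t) :
    ∀ t : ℝ, 0 < t → f t = g t := by
  obtain rfl : f = _ := funext hf
  obtain rfl : g = _ := funext hg
  obtain ⟨s, hs⟩ := exists_between ht
  exact (analyticOnNhd_tsum_mul_exp_neg_mul (fun n => (hlam n).le) ha)
    |>.eqOn_of_preconnected_of_eventuallyEq
    (analyticOnNhd_tsum_mul_exp_neg_mul (fun n => (hlam n).le) hb) isPreconnected_Ioi
    (ht₁.trans_lt hs.1) (Filter.mem_of_superset (Ioo_mem_nhds hs.1 hs.2) heq)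
end

section
/- Let λ : ℕ → ℝ be strictly monotone increasing with 0 < λ 0, let m : ℕ → ℕ, and let a, b : ℕ → ℂ satisfy Summable (fun k => ‖a k‖) and Summable (fun k => ‖b k‖), with b k = 0 whenever m k = 0. Let θ₁, θ₂ : ℝ with (θ₁ - θ₂)/π irrational. For j = 1, 2 define F_j : ℝ → ℂ by F_j t = ∑' k, (a k * Complex.exp (-Complex.I * (m k) * θ_j) + b k * Complex.exp (Complex.I * (m k) * θ_j)) * (1 - Complex.exp (-(λ k) * t)). Suppose there exist reals 0 ≤ t₁ < t̃₁ and 0 ≤ t₂ < t̃₂ such that F_1 t = 0 for all t ∈ (t₁, t̃₁) and F_2 t = 0 for all t ∈ (t₂, t̃₂). Then a k = 0 and b k = 0 for every k. -/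
open Filter Topology

lemma norm_cexp_neg_ofReal_mul_le_one {r : ℝ} (hr : 0 ≤ r) {z : ℂ} (hz : 0 ≤ z.re) :
    ‖Complex.exp (-(r : ℂ) * z)‖ ≤ 1 := by
  rw [Complex.norm_exp, Real.exp_le_one_iff]
  have : (-(r : ℂ) * z).re = -(r * z.re) := by simp
  rw [this]
  exact neg_nonpos.mpr (mul_nonneg hr hz)

lemma tendsto_cexp_neg_ofReal_mul_atTop {r : ℝ} (hr : 0 < r) :
    Tendsto (fun t : ℝ => Complex.exp (-(r : ℂ) * (t : ℂ))) atTop (𝓝 0) := by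
  rw [tendsto_zero_iff_norm_tendsto_zero]
  have h : ∀ t : ℝ, ‖Complex.exp (-(r : ℂ) * (t : ℂ))‖ = Real.exp (-(r * t)) := fun t => by
    rw [Complex.norm_exp]
    simp
  simp_rw [h]
  exact Real.tendsto_exp_neg_atTop_nhds_zero.comp (tendsto_id.const_mul_atTop hr)

/-- The coefficients of an absolutely convergent Dirichlet series with increasing exponents are
determined by its values on the positive half-line. -/
lemma eq_zero_of_tsum_mul_cexp_eq_zero {lam : ℕ → ℝ} (hmono : StrictMono lam) {c : ℕ → ℂ}
    (hc : Summable (fun k => ‖c k‖))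
    (h : ∀ t : ℝ, 0 < t → ∑' k, c k * Complex.exp (-(lam k : ℂ) * (t : ℂ)) = 0) (n : ℕ) :
    c n = 0 := by
  induction n using Nat.strong_induction_on with
  | _ n ih =>
    have hlim : Tendsto
        (fun t : ℝ => ∑' k, c k * Complex.exp (-((lam k - lam n : ℝ) : ℂ) * (t : ℂ)))
        atTop (𝓝 (∑' k, if k = n then c n else 0)) := by
      refine tendsto_tsum_of_dominated_convergence hc (fun k => ?_) ?_
      · rcases lt_trichotomy k n with hk | rfl | hk
        · simp [ih k hk, hk.ne]
        · simp
        · simpa [hk.ne'] using (tendsto_cexp_neg_ofReal_mul_atTop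
            (sub_pos.mpr (hmono hk))).const_mul (c k)
      · filter_upwards [eventually_ge_atTop 0] with t ht k
        rcases lt_or_ge k n with hk | hk
        · simp [ih k hk]
        · rw [norm_mul]
          exact mul_le_of_le_one_right (norm_nonneg _) (norm_cexp_neg_ofReal_mul_le_one
            (sub_nonneg.mpr (hmono.monotone hk)) (by simpa using ht))
    have hzero : (fun t : ℝ => ∑' k, c k * Complex.exp (-((lam k - lam n : ℝ) : ℂ) * (t : ℂ)))
        =ᶠ[atTop] fun _ => 0 := by
      filter_upwards [eventually_gt_atTop 0] with t ht
      have hfactor : ∀ k, c k * Complex.exp (-((lam k - lam n : ℝ) : ℂ) * (t : ℂ)) =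
          c k * Complex.exp (-(lam k : ℂ) * (t : ℂ)) * Complex.exp ((lam n : ℂ) * (t : ℂ)) := by
        intro k
        rw [mul_assoc, ← Complex.exp_add]
        congr 2
        push_cast
        ring
      simp_rw [hfactor]
      rw [tsum_mul_right, h t ht, zero_mul]
    have := tendsto_nhds_unique (hlim.congr' hzero) tendsto_const_nhds
    simpa using this

lemma eq_zero_of_tsum_mul_one_sub_cexp_eq_zero_on_Ioo {lam : ℕ → ℝ} (hmono : StrictMono lam)
    (hpos : 0 < lam 0) {c : ℕ → ℂ} (hc : Summable (fun k => ‖c k‖)) {s s' : ℝ} (hs : 0 ≤ s)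
    (hss' : s < s')
    (h : ∀ t ∈ Set.Ioo s s', ∑' k, c k * (1 - Complex.exp (-(lam k : ℂ) * (t : ℂ))) = 0) (n : ℕ) :
    c n = 0 := by
  have hlam : ∀ k, 0 < lam k := fun k => hpos.trans_le (hmono.monotone k.zero_le)
  set U : Set ℂ := {z | 0 < z.re}
  have hUo : IsOpen U := isOpen_lt continuous_const Complex.continuous_re
  set f : ℂ → ℂ := fun z => ∑' k, c k * (1 - Complex.exp (-(lam k : ℂ) * z))
  have hfan : AnalyticOnNhd ℂ f U := by
    refine DifferentiableOn.analyticOnNhd ?_ hUo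
    refine Complex.differentiableOn_tsum_of_summable_norm (u := fun k => ‖c k‖ * 2)
      (hc.mul_right 2) (fun k => by fun_prop) hUo (fun k z hz => ?_)
    rw [norm_mul]
    gcongr
    calc ‖1 - Complex.exp (-(lam k : ℂ) * z)‖ ≤ ‖(1 : ℂ)‖ + ‖Complex.exp (-(lam k : ℂ) * z)‖ :=
          norm_sub_le _ _
      _ ≤ 1 + 1 := by
          rw [norm_one]
          gcongr
          exact norm_cexp_neg_ofReal_mul_le_one (hlam k).le (le_of_lt hz)
      _ = 2 := by norm_num
  obtain ⟨x, hx⟩ := exists_between hss'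
  have hfreq : ∃ᶠ z in 𝓝[≠] (x : ℂ), f z = 0 := by
    have htend : Tendsto (fun t : ℝ => (t : ℂ)) (𝓝[≠] x) (𝓝[≠] (x : ℂ)) :=
      Complex.continuous_ofReal.continuousWithinAt.tendsto_nhdsWithin
        (fun t ht => by simpa using ht)
    refine htend.frequently (Eventually.frequently ?_)
    filter_upwards [nhdsWithin_le_nhds (Ioo_mem_nhds hx.1 hx.2)] with t ht using h t ht
  have hzero := hfan.eqOn_zero_of_preconnected_of_frequently_eq_zero
    (convex_halfSpace_re_gt 0).isPreconnected (show (x : ℂ) ∈ U from hs.trans_lt hx.1) hfreq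
  have hreal : ∀ t : ℝ, 0 < t →
      ∑' k, c k * (1 - Complex.exp (-(lam k : ℂ) * (t : ℂ))) = 0 :=
    fun t ht => hzero (show (t : ℂ) ∈ U from ht)
  have hsummable : ∀ t : ℝ, 0 < t →
      Summable fun k => c k * Complex.exp (-(lam k : ℂ) * (t : ℂ)) := fun t ht =>
    Summable.of_norm_bounded hc fun k => by
      rw [norm_mul]
      exact mul_le_of_le_one_right (norm_nonneg _)
        (norm_cexp_neg_ofReal_mul_le_one (hlam k).le (by simpa using ht.le))
  have hsplit : ∀ t : ℝ, 0 < t →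
      ∑' k, c k * Complex.exp (-(lam k : ℂ) * (t : ℂ)) = ∑' k, c k := by
    intro t ht
    have := hreal t ht
    simp_rw [mul_sub, mul_one] at this
    rw [hc.of_norm.tsum_sub (hsummable t ht)] at this
    exact (sub_eq_zero.mp this).symm
  have hlim : Tendsto (fun t : ℝ => ∑' k, c k * Complex.exp (-(lam k : ℂ) * (t : ℂ)))
      atTop (𝓝 (∑' _ : ℕ, (0 : ℂ))) := by
    refine tendsto_tsum_of_dominated_convergence hc (fun k => ?_) ?_
    · simpa using (tendsto_cexp_neg_ofReal_mul_atTop (hlam k)).const_mul (c k)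
    · filter_upwards [eventually_ge_atTop 0] with t ht k
      rw [norm_mul]
      exact mul_le_of_le_one_right (norm_nonneg _)
        (norm_cexp_neg_ofReal_mul_le_one (hlam k).le (by simpa using ht))
  have hsum : ∑' k, c k = 0 := by
    have hconst := hlim.congr' ((eventually_gt_atTop 0).mono hsplit)
    simpa using tendsto_nhds_unique tendsto_const_nhds hconst
  exact eq_zero_of_tsum_mul_cexp_eq_zero hmono hc (fun t ht => (hsplit t ht).trans hsum) n

lemma summable_norm_angular_coeff {a b : ℕ → ℂ} (ha : Summable (fun k => ‖a k‖))
    (hb : Summable (fun k => ‖b k‖)) (m : ℕ → ℕ) (θ : ℝ) :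
    Summable (fun k => ‖a k * Complex.exp (-Complex.I * (m k : ℂ) * (θ : ℂ)) +
      b k * Complex.exp (Complex.I * (m k : ℂ) * (θ : ℂ))‖) := by
  refine (ha.add hb).of_nonneg_of_le (fun k => norm_nonneg _) fun k => (norm_add_le _ _).trans ?_
  simp [Complex.norm_exp]

lemma eq_zero_of_angular_eq_zero {θ₁ θ₂ : ℝ} (hirr : Irrational ((θ₁ - θ₂) / Real.pi)) {m : ℕ}
    (hm : m ≠ 0) {a b : ℂ}
    (h₁ : a * Complex.exp (-Complex.I * (m : ℂ) * (θ₁ : ℂ)) +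
      b * Complex.exp (Complex.I * (m : ℂ) * (θ₁ : ℂ)) = 0)
    (h₂ : a * Complex.exp (-Complex.I * (m : ℂ) * (θ₂ : ℂ)) +
      b * Complex.exp (Complex.I * (m : ℂ) * (θ₂ : ℂ)) = 0) :
    a = 0 ∧ b = 0 := by
  have hrot : ∀ θ : ℝ, a * Complex.exp (-Complex.I * (m : ℂ) * (θ : ℂ)) +
      b * Complex.exp (Complex.I * (m : ℂ) * (θ : ℂ)) = 0 →
      a + b * Complex.exp (2 * Complex.I * (m : ℂ) * (θ : ℂ)) = 0 := by
    intro θ h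
    have hmul := congrArg (· * Complex.exp (Complex.I * (m : ℂ) * (θ : ℂ))) h
    simp only [add_mul, zero_mul, mul_assoc a, mul_assoc b, ← Complex.exp_add] at hmul
    ring_nf at hmul ⊢
    simpa using hmul
  have hb : b = 0 := by
    by_contra hb
    have hexp : Complex.exp (2 * Complex.I * (m : ℂ) * (θ₁ : ℂ)) =
        Complex.exp (2 * Complex.I * (m : ℂ) * (θ₂ : ℂ)) :=
      mul_left_cancel₀ hb (add_left_cancel ((hrot θ₁ h₁).trans (hrot θ₂ h₂).symm))
    obtain ⟨n, hn⟩ := Complex.exp_eq_exp_iff_exists_int.mp hexp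
    have hC : (2 * Complex.I) * ((m : ℂ) * ((θ₁ : ℂ) - θ₂)) = (2 * Complex.I) * (n * Real.pi) := by
      linear_combination hn
    have hR : (m : ℝ) * (θ₁ - θ₂) = n * Real.pi := by
      exact_mod_cast mul_left_cancel₀ (mul_ne_zero two_ne_zero Complex.I_ne_zero) hC
    refine hirr ⟨(n : ℚ) / m, ?_⟩
    have hm' : (m : ℝ) ≠ 0 := Nat.cast_ne_zero.mpr hm
    push_cast
    rw [div_eq_div_iff hm' Real.pi_ne_zero]
    linarith
  have ha := hrot θ₁ h₁
  rw [hb, zero_mul, add_zero] at ha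
  exact ⟨ha, hb⟩

theorem two_angle_flux_vanishing_on_windows
    (lam : ℕ → ℝ) (hmono : StrictMono lam) (hpos : 0 < lam 0)
    (m : ℕ → ℕ) (a b : ℕ → ℂ)
    (ha : Summable (fun k => ‖a k‖)) (hb : Summable (fun k => ‖b k‖))
    (hb0 : ∀ k, m k = 0 → b k = 0)
    (θ₁ θ₂ : ℝ) (hirr : Irrational ((θ₁ - θ₂) / Real.pi))
    (F₁ F₂ : ℝ → ℂ)
    (hF₁ : ∀ t : ℝ, F₁ t =
      ∑' k, (a k * Complex.exp (-Complex.I * (m k : ℂ) * (θ₁ : ℂ)) +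
             b k * Complex.exp (Complex.I * (m k : ℂ) * (θ₁ : ℂ))) *
            (1 - Complex.exp (-(lam k : ℂ) * (t : ℂ))))
    (hF₂ : ∀ t : ℝ, F₂ t =
      ∑' k, (a k * Complex.exp (-Complex.I * (m k : ℂ) * (θ₂ : ℂ)) +
             b k * Complex.exp (Complex.I * (m k : ℂ) * (θ₂ : ℂ))) *
            (1 - Complex.exp (-(lam k : ℂ) * (t : ℂ))))
    (t₁ t₁' : ℝ) (ht₁ : 0 ≤ t₁) (ht₁' : t₁ < t₁')
    (t₂ t₂' : ℝ) (ht₂ : 0 ≤ t₂) (ht₂' : t₂ < t₂')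
    (h1 : ∀ t ∈ Set.Ioo t₁ t₁', F₁ t = 0)
    (h2 : ∀ t ∈ Set.Ioo t₂ t₂', F₂ t = 0) :
    ∀ k, a k = 0 ∧ b k = 0 := by
  intro k
  have hk₁ := eq_zero_of_tsum_mul_one_sub_cexp_eq_zero_on_Ioo hmono hpos
    (summable_norm_angular_coeff ha hb m θ₁) ht₁ ht₁' (fun t ht => (hF₁ t).symm.trans (h1 t ht)) k
  have hk₂ := eq_zero_of_tsum_mul_one_sub_cexp_eq_zero_on_Ioo hmono hpos
    (summable_norm_angular_coeff ha hb m θ₂) ht₂ ht₂' (fun t ht => (hF₂ t).symm.trans (h2 t ht)) k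
  by_cases hm : m k = 0
  · refine ⟨?_, hb0 k hm⟩
    simpa [hm, hb0 k hm] using hk₁
  · exact eq_zero_of_angular_eq_zero hirr hm hk₁ hk₂
end
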